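/- Let n ≥ 3. In the poset of consistent subsets of binom([n], 3) ordered by inclusion, the pair (∅, binom([n], 3)) is facial, Asc(∅) = {{i, i+1, i+2} : 1 ≤ i ≤ n−2}, and the Möbius function satisfies μ(∅, binom([n], 3)) = (−1)^n. -/

import Mathlib

open Finset

/-- `[n] = {1, …, n}`. -/
def box (n : ℕ) : Finset ℕ := Finset.Icc 1 n

/-- `binom([n], k)`, the set of `k`-element subsets of `[n]`. -/
def binom (n k : ℕ) : Finset (Finset ℕ) := Finset.powersetCard k (box n)

/-- `X ⊆ binom([n], d+1)` is closed if for every `(d-1)`-subset `I` of `[n]` and all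
`i < j < k` in `[n] ∖ I`, membership of `I∪{i,j}` and `I∪{j,k}` in `X` forces
`I∪{i,k} ∈ X`. -/
def IsClosedSet (n d : ℕ) (X : Finset (Finset ℕ)) : Prop :=
  ∀ I ∈ binom n (d - 1), ∀ i ∈ box n, ∀ j ∈ box n, ∀ k ∈ box n,
    i ∉ I → j ∉ I → k ∉ I → i < j → j < k →
      I ∪ {i, j} ∈ X → I ∪ {j, k} ∈ X → I ∪ {i, k} ∈ X

/-- `X` is a consistent subset of `binom([n], d+1)`:
both `X` and its complement in `binom([n], d+1)` are closed. -/
def Consistent (n d : ℕ) (X : Finset (Finset ℕ)) : Prop :=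
  X ⊆ binom n (d + 1) ∧ IsClosedSet n d X ∧ IsClosedSet n d (binom n (d + 1) \ X)

open Classical in
/-- The smallest closed subset of `binom([n], d+1)` containing `S`. -/
noncomputable def closureHB (n d : ℕ) (S : Finset (Finset ℕ)) : Finset (Finset ℕ) :=
  (binom n (d + 1)).filter fun I =>
    ∀ T ⊆ binom n (d + 1), S ⊆ T → IsClosedSet n d T → I ∈ T

open Classical in
/-- The ascent set `Asc(X, Y) = {I ∈ Y ∖ X : X ∪ {I} is consistent}`. -/
noncomputable def ascSet (n d : ℕ) (X Y : Finset (Finset ℕ)) : Finset (Finset ℕ) :=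
  (Y \ X).filter fun I => Consistent n d (X ∪ {I})

/-- The pair `(X, Y)` of consistent sets is facial if `Y = X ∪ cl(Asc(X,Y))` and
`X ∪ cl(𝓘)` is consistent for every `𝓘 ⊆ Asc(X,Y)`. -/
def Facial (n : ℕ) (X Y : Finset (Finset ℕ)) : Prop :=
  Consistent n 2 X ∧ Consistent n 2 Y ∧ X ⊆ Y ∧
  Y = X ∪ closureHB n 2 (ascSet n 2 X Y) ∧
  ∀ S ⊆ ascSet n 2 X Y, Consistent n 2 (X ∪ closureHB n 2 S)

/-- The poset of consistent subsets of `binom([n], 3)`, ordered by inclusion. -/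
def ConsPoset (n : ℕ) := {X : Finset (Finset ℕ) // Consistent n 2 X}

noncomputable instance (n : ℕ) : PartialOrder (ConsPoset n) :=
  Subtype.partialOrder _

open Classical in
noncomputable instance (n : ℕ) : LocallyFiniteOrder (ConsPoset n) :=
  Subtype.instLocallyFiniteOrder _

open Classical in
/-- The Möbius function of the poset of consistent subsets of `binom([n],3)`
ordered by inclusion. -/
noncomputable def muHB (n : ℕ) : ConsPoset n → ConsPoset n → ℤ :=
  fun X Y => IncidenceAlgebra.mu ℤ X Y

theorem union_pair_left (a i j : ℕ) : ({a} ∪ {i, j} : Finset ℕ) = {a, i, j} := rfl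

theorem union_pair_mid (a i j : ℕ) : ({a} ∪ {i, j} : Finset ℕ) = {i, a, j} := by
  ext; simp

theorem union_pair_right (a i j : ℕ) : ({a} ∪ {i, j} : Finset ℕ) = {i, j, a} := by
  ext; simp; tauto

theorem triple_mem_binom {n a b c : ℕ} (hab : a < b) (hbc : b < c) :
    ({a, b, c} : Finset ℕ) ∈ binom n 3 ↔ 1 ≤ a ∧ c ≤ n := by
  have hcard : ({a, b, c} : Finset ℕ).card = 3 :=
    Finset.card_eq_three.2 ⟨a, b, c, by omega, by omega, by omega, rfl⟩
  simp only [binom, _root_.box, Finset.mem_powersetCard, hcard, and_true, Finset.insert_subset_iff,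
    Finset.singleton_subset_iff, Finset.mem_Icc]
  omega

theorem exists_triple_of_mem_binom {n : ℕ} {I : Finset ℕ} (hI : I ∈ binom n 3) :
    ∃ a b c, a < b ∧ b < c ∧ I = {a, b, c} := by
  obtain ⟨x, y, z, hxy, hxz, hyz, rfl⟩ := Finset.card_eq_three.1 (Finset.mem_powersetCard.1 hI).2
  rcases lt_or_gt_of_ne hxy with h1 | h1 <;> rcases lt_or_gt_of_ne hxz with h2 | h2 <;>
    rcases lt_or_gt_of_ne hyz with h3 | h3
  · exact ⟨x, y, z, h1, h3, rfl⟩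
  · exact ⟨x, z, y, h2, h3, by ext; simp; tauto⟩
  · omega
  · exact ⟨z, x, y, h2, h1, by ext; simp; tauto⟩
  · exact ⟨y, x, z, h1, h2, by ext; simp; tauto⟩
  · omega
  · exact ⟨y, z, x, h3, h2, by ext; simp; tauto⟩
  · exact ⟨z, y, x, h3, h1, by ext; simp; tauto⟩

/-- Closedness of a family of triples, read off on the lexicographically ordered packets
`abc, abd, acd, bcd`. -/
theorem isClosedSet_two_iff (n : ℕ) (X : Finset (Finset ℕ)) :
    IsClosedSet n 2 X ↔ ∀ a b c d : ℕ, 1 ≤ a → a < b → b < c → c < d → d ≤ n →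
      (({a, b, c} : Finset ℕ) ∈ X → ({a, c, d} : Finset ℕ) ∈ X → ({a, b, d} : Finset ℕ) ∈ X) ∧
      (({a, b, c} : Finset ℕ) ∈ X → ({b, c, d} : Finset ℕ) ∈ X → ({a, b, d} : Finset ℕ) ∈ X) ∧
      (({a, b, c} : Finset ℕ) ∈ X → ({b, c, d} : Finset ℕ) ∈ X → ({a, c, d} : Finset ℕ) ∈ X) ∧
      (({a, b, d} : Finset ℕ) ∈ X → ({b, c, d} : Finset ℕ) ∈ X → ({a, c, d} : Finset ℕ) ∈ X) := by
  constructor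
  · intro h a b c d ha hab hbc hcd hd
    have key : ∀ e i j k : ℕ, 1 ≤ e → e ≤ n → 1 ≤ i → k ≤ n → i < j → j < k →
        e ≠ i → e ≠ j → e ≠ k → ({e} ∪ {i, j} : Finset ℕ) ∈ X →
        ({e} ∪ {j, k} : Finset ℕ) ∈ X → ({e} ∪ {i, k} : Finset ℕ) ∈ X := by
      intro e i j k he he' hi hk hij hjk h1 h2 h3
      refine h {e} ?_ i ?_ j ?_ k ?_ ?_ ?_ ?_ hij hjk
      · simp [binom, _root_.box, he, he']
      all_goals simp [_root_.box]; omega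
    refine ⟨?_, ?_, ?_, ?_⟩
    · simpa only [union_pair_left] using key a b c d (by omega) (by omega) (by omega) (by omega)
        (by omega) (by omega) (by omega) (by omega) (by omega)
    · have := key b a c d (by omega) (by omega) (by omega) (by omega)
        (by omega) (by omega) (by omega) (by omega) (by omega)
      rwa [union_pair_mid b a c, union_pair_left b c d, union_pair_mid b a d] at this
    · have := key c a b d (by omega) (by omega) (by omega) (by omega)
        (by omega) (by omega) (by omega) (by omega) (by omega)
      rwa [union_pair_right c a b, union_pair_mid c b d, union_pair_mid c a d] at this
    · have := key d a b c (by omega) (by omega) (by omega) (by omega)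
        (by omega) (by omega) (by omega) (by omega) (by omega)
      rwa [union_pair_right d a b, union_pair_right d b c, union_pair_right d a c] at this
  · intro h I hI i hi j hj k hk hiI hjI hkI hij hjk
    obtain ⟨hsub, hcard⟩ := Finset.mem_powersetCard.1 hI
    obtain ⟨e, rfl⟩ := Finset.card_eq_one.1 hcard
    simp only [_root_.box, Finset.singleton_subset_iff, Finset.mem_Icc, Finset.mem_singleton] at *
    rcases lt_or_gt_of_ne hiI with h1 | h1
    · rcases lt_or_gt_of_ne hjI with h2 | h2
      · rcases lt_or_gt_of_ne hkI with h3 | h3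
        · rw [union_pair_right e i j, union_pair_right e j k, union_pair_right e i k]
          exact (h i j k e (by omega) hij hjk h3 (by omega)).2.2.2
        · rw [union_pair_right e i j, union_pair_mid e j k, union_pair_mid e i k]
          exact (h i j e k (by omega) hij h2 h3 (by omega)).2.2.1
      · rw [union_pair_mid e i j, union_pair_left e j k, union_pair_mid e i k]
        exact (h i e j k (by omega) h1 h2 hjk (by omega)).2.1
    · rw [union_pair_left e i j, union_pair_left e j k, union_pair_left e i k]
      exact (h e i j k (by omega) h1 hij hjk (by omega)).1

/-- The consecutive triples `{i, i+1, i+2}` in `[n]`. -/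
def consecutiveTriples (n : ℕ) : Finset (Finset ℕ) :=
  (Finset.Icc 1 (n - 2)).image (fun i => ({i, i + 1, i + 2} : Finset ℕ))

theorem mem_consecutiveTriples {n : ℕ} {I : Finset ℕ} :
    I ∈ consecutiveTriples n ↔ ∃ i, 1 ≤ i ∧ i + 2 ≤ n ∧ I = {i, i + 1, i + 2} := by
  simp only [consecutiveTriples, Finset.mem_image, Finset.mem_Icc]
  constructor
  · rintro ⟨i, hi, rfl⟩
    exact ⟨i, by omega, by omega, rfl⟩
  · rintro ⟨i, h1, h2, rfl⟩
    exact ⟨i, by omega, rfl⟩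

theorem consecutiveTriples_subset (n : ℕ) : consecutiveTriples n ⊆ binom n 3 := by
  intro I hI
  obtain ⟨i, h1, h2, rfl⟩ := mem_consecutiveTriples.1 hI
  exact (triple_mem_binom (by omega) (by omega)).2 ⟨h1, h2⟩

theorem triple_injective {a b c a' b' c' : ℕ} (hab : a < b) (hbc : b < c) (hab' : a' < b')
    (hbc' : b' < c') (h : ({a, b, c} : Finset ℕ) = {a', b', c'}) : a = a' ∧ b = b' ∧ c = c' := by
  have ha : a ∈ ({a', b', c'} : Finset ℕ) := h ▸ (by simp)
  have hb : b ∈ ({a', b', c'} : Finset ℕ) := h ▸ (by simp)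
  have hc : c ∈ ({a', b', c'} : Finset ℕ) := h ▸ (by simp)
  simp only [Finset.mem_insert, Finset.mem_singleton] at ha hb hc
  omega

theorem card_consecutiveTriples (n : ℕ) : (consecutiveTriples n).card = n - 2 := by
  rw [consecutiveTriples, Finset.card_image_of_injective, Nat.card_Icc, Nat.add_sub_cancel]
  intro i j h
  exact (triple_injective (by omega) (by omega) (by omega) (by omega) h).1

open Classical in
/-- The triples `{a < b < c}` in `[n]` such that every consecutive triple in the interval
`[a, c]` lies in `S`. -/
noncomputable def fillTriples (n : ℕ) (S : Finset (Finset ℕ)) : Finset (Finset ℕ) :=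
  (binom n 3).filter fun I =>
    ∀ i, (∃ x ∈ I, x ≤ i) → (∃ y ∈ I, i + 2 ≤ y) → ({i, i + 1, i + 2} : Finset ℕ) ∈ S

theorem triple_mem_fillTriples {n : ℕ} {S : Finset (Finset ℕ)} {a b c : ℕ} (hab : a < b)
    (hbc : b < c) : ({a, b, c} : Finset ℕ) ∈ fillTriples n S ↔
      (1 ≤ a ∧ c ≤ n) ∧ ∀ i, a ≤ i → i + 2 ≤ c → ({i, i + 1, i + 2} : Finset ℕ) ∈ S := by
  simp only [fillTriples, Finset.mem_filter, triple_mem_binom hab hbc]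
  refine and_congr_right fun _ => forall_congr' fun i => ?_
  constructor
  · intro h h1 h2
    exact h ⟨a, by simp, h1⟩ ⟨c, by simp, h2⟩
  · rintro h ⟨x, hx, hxi⟩ ⟨y, hy, hyi⟩
    simp only [Finset.mem_insert, Finset.mem_singleton] at hx hy
    exact h (by omega) (by omega)

theorem fillTriples_subset (n : ℕ) (S : Finset (Finset ℕ)) : fillTriples n S ⊆ binom n 3 :=
  fun _ h => by
    simp only [fillTriples, Finset.mem_filter] at h
    exact h.1

theorem consistent_fillTriples (n : ℕ) (S : Finset (Finset ℕ)) :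
    Consistent n 2 (fillTriples n S) := by
  refine ⟨fillTriples_subset n S, ?_, ?_⟩ <;> rw [isClosedSet_two_iff] <;>
    intro a b c d ha hab hbc hcd hd
  all_goals
    have e1 := triple_mem_fillTriples (n := n) (S := S) hab hbc
    have e2 := triple_mem_fillTriples (n := n) (S := S) hab (hbc.trans hcd)
    have e3 := triple_mem_fillTriples (n := n) (S := S) (hab.trans hbc) hcd
    have e4 := triple_mem_fillTriples (n := n) (S := S) hbc hcd
    have h23 := e2.trans e3.symm
    have h14 : ({a, b, c} : Finset ℕ) ∈ fillTriples n S → ({b, c, d} : Finset ℕ) ∈ fillTriples n S →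
        ({a, b, d} : Finset ℕ) ∈ fillTriples n S := by
      rw [e1, e2, e4]
      rintro ⟨_, h1⟩ ⟨_, h4⟩
      refine ⟨by omega, fun i hi hi' => ?_⟩
      by_cases h : i + 2 ≤ c
      · exact h1 i hi h
      · exact h4 i (by omega) hi'
    have h21 : ({a, b, d} : Finset ℕ) ∈ fillTriples n S →
        ({a, b, c} : Finset ℕ) ∈ fillTriples n S := by
      rw [e1, e2]
      rintro ⟨_, h⟩
      exact ⟨by omega, fun i hi hi' => h i hi (by omega)⟩
  · exact ⟨fun _ h3 => h23.2 h3, h14, fun h1 h4 => h23.1 (h14 h1 h4), fun h2 _ => h23.1 h2⟩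
  · have m2 : ({a, b, d} : Finset ℕ) ∈ binom n (2 + 1) :=
      (triple_mem_binom hab (hbc.trans hcd)).2 (by omega)
    have m3 : ({a, c, d} : Finset ℕ) ∈ binom n (2 + 1) :=
      (triple_mem_binom (hab.trans hbc) hcd).2 (by omega)
    simp only [Finset.mem_sdiff]
    exact ⟨fun _ k3 => ⟨m2, fun h => k3.2 (h23.1 h)⟩, fun k1 _ => ⟨m2, fun h => k1.2 (h21 h)⟩,
      fun k1 _ => ⟨m3, fun h => k1.2 (h21 (h23.2 h))⟩, fun k2 _ => ⟨m3, fun h => k2.2 (h23.2 h)⟩⟩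

theorem subset_fillTriples {n : ℕ} {S : Finset (Finset ℕ)} (hS : S ⊆ consecutiveTriples n) :
    S ⊆ fillTriples n S := by
  intro I hI
  obtain ⟨i, h1, h2, rfl⟩ := mem_consecutiveTriples.1 (hS hI)
  rw [triple_mem_fillTriples (by omega) (by omega)]
  refine ⟨⟨h1, h2⟩, fun k hk hk' => ?_⟩
  obtain rfl : k = i := by omega
  exact hI

theorem fillTriples_subset_of_isClosedSet {n : ℕ} {S T : Finset (Finset ℕ)} (hST : S ⊆ T)
    (hT : IsClosedSet n 2 T) : fillTriples n S ⊆ T := by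
  rw [isClosedSet_two_iff] at hT
  have key : ∀ m a b c : ℕ, c - a ≤ m → a < b → b < c →
      ({a, b, c} : Finset ℕ) ∈ fillTriples n S → ({a, b, c} : Finset ℕ) ∈ T := by
    intro m
    induction m with
    | zero => intros; omega
    | succ m ih =>
      intro a b c hm hab hbc h
      obtain ⟨hb, hS⟩ := (triple_mem_fillTriples hab hbc).1 h
      have sub : ∀ x y z, a ≤ x → z ≤ c → z - x < c - a → x < y → y < z →
          ({x, y, z} : Finset ℕ) ∈ T := fun x y z hx hz hlt hxy hyz =>
        ih x y z (by omega) hxy hyz ((triple_mem_fillTriples hxy hyz).2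
          ⟨by omega, fun i hi hi' => hS i (by omega) (by omega)⟩)
      by_cases h1 : a + 1 < b
      · exact (hT a (a + 1) b c hb.1 (by omega) h1 hbc hb.2).2.2.1
          (sub _ _ _ (by omega) (by omega) (by omega) (by omega) (by omega))
          (sub _ _ _ (by omega) (by omega) (by omega) (by omega) (by omega))
      · by_cases h2 : b + 1 < c
        · exact (hT a b (c - 1) c hb.1 hab (by omega) (by omega) hb.2).2.1
            (sub _ _ _ (by omega) (by omega) (by omega) (by omega) (by omega))
            (sub _ _ _ (by omega) (by omega) (by omega) (by omega) (by omega))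
        · obtain rfl : b = a + 1 := by omega
          obtain rfl : c = a + 2 := by omega
          exact hST (hS a le_rfl le_rfl)
  intro I hI
  obtain ⟨a, b, c, hab, hbc, rfl⟩ := exists_triple_of_mem_binom (fillTriples_subset n S hI)
  exact key _ a b c le_rfl hab hbc hI

theorem closureHB_eq_fillTriples {n : ℕ} {S : Finset (Finset ℕ)}
    (hS : S ⊆ consecutiveTriples n) : closureHB n 2 S = fillTriples n S := by
  ext I
  simp only [closureHB, Finset.mem_filter]
  constructor
  · rintro ⟨_, h⟩
    exact h _ (fillTriples_subset n S) (subset_fillTriples hS) (consistent_fillTriples n S).2.1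
  · exact fun h => ⟨fillTriples_subset n S h, fun T _ hST hT =>
      fillTriples_subset_of_isClosedSet hST hT h⟩

theorem fillTriples_eq_binom_iff {n : ℕ} {S : Finset (Finset ℕ)} :
    fillTriples n S = binom n 3 ↔ consecutiveTriples n ⊆ S := by
  constructor
  · intro h I hI
    have hmem := consecutiveTriples_subset n hI
    obtain ⟨i, h1, h2, rfl⟩ := mem_consecutiveTriples.1 hI
    rw [← h, triple_mem_fillTriples (by omega) (by omega)] at hmem
    exact hmem.2 i le_rfl le_rfl
  · intro h
    refine (fillTriples_subset n S).antisymm fun I hI => ?_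
    obtain ⟨a, b, c, hab, hbc, rfl⟩ := exists_triple_of_mem_binom hI
    rw [triple_mem_binom hab hbc] at hI
    exact (triple_mem_fillTriples hab hbc).2 ⟨hI, fun i hi hi' =>
      h (mem_consecutiveTriples.2 ⟨i, by omega, by omega, rfl⟩)⟩

theorem consistent_empty (n : ℕ) : Consistent n 2 ∅ := by
  have h : fillTriples n ∅ = ∅ := by
    refine Finset.eq_empty_of_forall_notMem fun I hI => ?_
    obtain ⟨a, b, c, hab, hbc, rfl⟩ := exists_triple_of_mem_binom (fillTriples_subset n ∅ hI)
    exact Finset.notMem_empty _ (((triple_mem_fillTriples hab hbc).1 hI).2 a le_rfl (by omega))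
  exact h ▸ consistent_fillTriples n ∅

theorem consistent_binom (n : ℕ) : Consistent n 2 (binom n 3) :=
  fillTriples_eq_binom_iff.2 (Finset.Subset.refl (consecutiveTriples n)) ▸
    consistent_fillTriples n (consecutiveTriples n)

theorem exists_consecutive_mem_of_consistent {n : ℕ} {X : Finset (Finset ℕ)}
    (hX : Consistent n 2 X) (hne : X.Nonempty) : ∃ I ∈ consecutiveTriples n, I ∈ X := by
  obtain ⟨hsub, -, hco⟩ := hX
  rw [isClosedSet_two_iff] at hco
  have key : ∀ m a b c : ℕ, c - a ≤ m → a < b → b < c → ({a, b, c} : Finset ℕ) ∈ X →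
      ∃ I ∈ consecutiveTriples n, I ∈ X := by
    intro m
    induction m with
    | zero => intros; omega
    | succ m ih =>
      intro a b c hm hab hbc h
      have hb := (triple_mem_binom hab hbc).1 (hsub h)
      by_contra hcon
      have sub : ∀ x y z, a ≤ x → z ≤ c → z - x < c - a → x < y → y < z →
          ({x, y, z} : Finset ℕ) ∈ binom n (2 + 1) \ X := fun x y z hx hz hlt hxy hyz =>
        Finset.mem_sdiff.2 ⟨(triple_mem_binom hxy hyz).2 (by omega),
          fun hmem => hcon (ih x y z (by omega) hxy hyz hmem)⟩
      by_cases h1 : a + 1 < b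
      · exact (Finset.mem_sdiff.1 ((hco a (a + 1) b c hb.1 (by omega) h1 hbc hb.2).2.2.1
          (sub _ _ _ (by omega) (by omega) (by omega) (by omega) (by omega))
          (sub _ _ _ (by omega) (by omega) (by omega) (by omega) (by omega)))).2 h
      · by_cases h2 : b + 1 < c
        · exact (Finset.mem_sdiff.1 ((hco a b (c - 1) c hb.1 hab (by omega) (by omega) hb.2).2.1
            (sub _ _ _ (by omega) (by omega) (by omega) (by omega) (by omega))
            (sub _ _ _ (by omega) (by omega) (by omega) (by omega) (by omega)))).2 h
        · obtain rfl : b = a + 1 := by omega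
          obtain rfl : c = a + 2 := by omega
          exact hcon ⟨_, mem_consecutiveTriples.2 ⟨a, hb.1, hb.2, rfl⟩, h⟩
  obtain ⟨I, hI⟩ := hne
  obtain ⟨a, b, c, hab, hbc, rfl⟩ := exists_triple_of_mem_binom (hsub hI)
  exact key _ a b c le_rfl hab hbc hI

theorem ascSet_empty_binom (n : ℕ) : ascSet n 2 ∅ (binom n 3) = consecutiveTriples n := by
  ext I
  simp only [ascSet, Finset.mem_filter, Finset.sdiff_empty, Finset.empty_union]
  constructor
  · rintro ⟨-, h⟩
    obtain ⟨J, hJ, hJI⟩ := exists_consecutive_mem_of_consistent h (Finset.singleton_nonempty I)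
    rwa [← Finset.mem_singleton.1 hJI]
  · intro hI
    refine ⟨consecutiveTriples_subset n hI, ?_⟩
    have h : fillTriples n {I} = {I} := by
      refine Finset.Subset.antisymm (fun J hJ => ?_)
        (subset_fillTriples (Finset.singleton_subset_iff.2 hI))
      obtain ⟨a, b, c, hab, hbc, rfl⟩ := exists_triple_of_mem_binom (fillTriples_subset n _ hJ)
      have hS := ((triple_mem_fillTriples hab hbc).1 hJ).2
      have h1 := Finset.mem_singleton.1 (hS a le_rfl (by omega))
      have h2 := Finset.mem_singleton.1 (hS (c - 2) (by omega) (by omega))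
      have h3 := (triple_injective (by omega) (by omega) (by omega) (by omega) (h1.trans h2.symm)).1
      obtain rfl : b = a + 1 := by omega
      obtain rfl : c = a + 2 := by omega
      exact Finset.mem_singleton.2 h1
    exact h ▸ consistent_fillTriples n {I}

/-- A crosscut formula: if every `S ⊆ A` has a join `j S` above `a`, where `A` is a finite set of
labels for relations `below s`, none holding at `a` and at least one holding strictly above `a`,
then the Möbius function at `(a, x)` counts the `S` with join `x`, with sign. -/
theorem mu_eq_sum_of_join {α β : Type*} [PartialOrder α] [LocallyFiniteOrder α] [DecidableEq α]
    (A : Finset β) (below : β → α → Prop) (j : Finset β → α) (a : α)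
    (hj : ∀ S ⊆ A, a ≤ j S) (hle : ∀ S ⊆ A, ∀ x, j S ≤ x ↔ ∀ s ∈ S, below s x)
    (hbot : ∀ s ∈ A, ¬ below s a) (hlt : ∀ x, a < x → ∃ s ∈ A, below s x) (x : α) (hx : a ≤ x) :
    IncidenceAlgebra.mu ℤ a x = ∑ S ∈ A.powerset with j S = x, (-1) ^ S.card := by
  classical
  have hsum : ∀ x, a ≤ x → ∑ y ∈ Finset.Icc a x,
      ∑ S ∈ A.powerset with j S = y, (-1 : ℤ) ^ S.card = if a = x then 1 else 0 := by
    intro x hx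
    have hfil : (A.powerset.filter fun S => j S ∈ Finset.Icc a x) =
        (A.filter fun s => below s x).powerset := by
      ext S
      simp only [Finset.mem_filter, Finset.mem_powerset, Finset.mem_Icc]
      constructor
      · rintro ⟨hS, -, h⟩ s hs
        exact Finset.mem_filter.2 ⟨hS hs, (hle S hS x).1 h s hs⟩
      · intro h
        have hS : S ⊆ A := h.trans (Finset.filter_subset _ _)
        exact ⟨hS, hj S hS, (hle S hS x).2 fun s hs => (Finset.mem_filter.1 (h hs)).2⟩
    have hfib := Finset.sum_fiberwise_eq_sum_filter A.powerset (Finset.Icc a x) j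
      (fun S => (-1 : ℤ) ^ S.card)
    rw [hfib, hfil, Finset.sum_powerset_neg_one_pow_card]
    refine if_congr ?_ rfl rfl
    rw [Finset.filter_eq_empty_iff]
    constructor
    · intro h
      by_contra hne
      obtain ⟨s, hs, hsx⟩ := hlt x (lt_of_le_of_ne hx hne)
      exact h hs hsx
    · rintro rfl s hs
      exact hbot s hs
  induction hk : (Finset.Icc a x).card using Nat.strong_induction_on generalizing x with
  | _ k ih =>
    have h := (IncidenceAlgebra.sum_Icc_mu_right (𝕜 := ℤ) a x).trans (hsum x hx).symm
    rw [← Finset.Ico_insert_right hx, Finset.sum_insert Finset.right_notMem_Ico,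
      Finset.sum_insert Finset.right_notMem_Ico, Finset.sum_congr rfl fun y hy => ?_] at h
    · exact add_right_cancel h
    · obtain ⟨hay, hyx⟩ := Finset.mem_Ico.1 hy
      refine ih _ ?_ y hay rfl
      rw [← hk]
      exact Finset.card_lt_card (Finset.Icc_ssubset_Icc_right hx le_rfl hyx)

/-- For `n ≥ 3`, the pair `(∅, binom([n],3))` is facial,
`Asc(∅) = {{i, i+1, i+2} : 1 ≤ i ≤ n-2}`, and `μ(∅, binom([n],3)) = (-1)^n`. -/
theorem mu_bottom_top (n : ℕ) (hn : 3 ≤ n) :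
    Facial n ∅ (binom n 3) ∧
    ascSet n 2 ∅ (binom n 3) =
      (Finset.Icc 1 (n - 2)).image (fun i => ({i, i + 1, i + 2} : Finset ℕ)) ∧
    ∀ (h1 : Consistent n 2 ∅) (h2 : Consistent n 2 (binom n 3)),
      muHB n ⟨∅, h1⟩ ⟨binom n 3, h2⟩ = (-1) ^ n := by
  refine ⟨⟨consistent_empty n, consistent_binom n, Finset.empty_subset _, ?_, ?_⟩,
    ascSet_empty_binom n, ?_⟩
  · rw [ascSet_empty_binom, Finset.empty_union, closureHB_eq_fillTriples (Finset.Subset.refl _),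
      fillTriples_eq_binom_iff.2 (Finset.Subset.refl _)]
  · intro S hS
    rw [ascSet_empty_binom] at hS
    rw [Finset.empty_union, closureHB_eq_fillTriples hS]
    exact consistent_fillTriples n S
  · intro h1 h2
    classical
    have hle : ∀ X Y : ConsPoset n, X ≤ Y ↔ X.1 ⊆ Y.1 := fun _ _ => Iff.rfl
    let j : Finset (Finset ℕ) → ConsPoset n :=
      fun S => ⟨fillTriples n S, consistent_fillTriples n S⟩
    have hmu := mu_eq_sum_of_join (consecutiveTriples n) (fun I (X : ConsPoset n) => I ∈ X.1) j
      ⟨∅, h1⟩ (fun S _ => (hle _ _).2 (Finset.empty_subset _))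
      (fun S hS X => ⟨fun h s hs => (hle _ _).1 h (subset_fillTriples hS hs), fun h =>
        (hle _ _).2 (fillTriples_subset_of_isClosedSet h X.2.2.1)⟩)
      (fun s _ => Finset.notMem_empty s)
      (fun X hX => exists_consecutive_mem_of_consistent X.2
        (Finset.nonempty_iff_ne_empty.2 fun h => hX.ne (Subtype.ext h.symm)))
      ⟨binom n 3, h2⟩ ((hle _ _).2 (Finset.empty_subset _))
    have hfil : ((consecutiveTriples n).powerset.filter fun S => j S = ⟨binom n 3, h2⟩) =
        {consecutiveTriples n} := by
      ext S
      rw [Finset.mem_filter, Finset.mem_powerset, Finset.mem_singleton]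
      refine (and_congr_right fun _ => ?_).trans Finset.Subset.antisymm_iff.symm
      exact Subtype.ext_iff.trans fillTriples_eq_binom_iff
    rw [hfil, Finset.sum_singleton, card_consecutiveTriples] at hmu
    have hpow : (-1 : ℤ) ^ (n - 2) = (-1) ^ n := by
      obtain ⟨m, rfl⟩ : ∃ m, n = m + 2 := ⟨n - 2, by omega⟩
      simp [pow_add]
    rw [← hpow, ← hmu]
    unfold muHB
    convert rfl
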